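/- Pointwise derivatives: let f ∈ 𝒟'(ℝ^d), x ∈ ℝ^d and δ > 0 be such that |f(φ_x^λ)| ≲ λ^δ uniformly over λ ∈ (0,1], for every fixed φ ∈ 𝓑_δ. Then: (1) for every multi-index k with 0 ≤ |k| < δ and every η ∈ 𝒟 with ∫η = 1 and ∫η(x)x^l dx = 0 for all 1 ≤ |l| < δ, the limit D^k f(x) := lim_{λ↓0} D^k f(η_x^λ) exists in ℝ and does not depend on the choice of η. (2) If in addition δ ∉ ℕ, then the distribution f − 𝒯^δ_x(f), where 𝒯^δ_x(f)(·) := Σ_{0≤|k|<δ} D^k f(x)(·−x)^k/k!, satisfies |(f − 𝒯^δ_x(f))(ψ_x^λ)| ≲ λ^δ uniformly over λ ∈ (0,1], for any fixed test function ψ supported in B(0,1). (3) The bound in (2) also holds for δ ∈ ℕ provided that for every multi-index k with |k| = δ and every test function φ supported in B(0,1), sup_{λ∈(0,1]} |D^k f(φ_x^λ)| ≲ 1. -/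

import Mathlib

open MeasureTheory Metric Filter
open scoped Classical Pointwise Topology

noncomputable section

/-- Euclidean space `ℝ^d`. -/
abbrev Ed (d : ℕ) := EuclideanSpace ℝ (Fin d)

/-- Multi-indices `k ∈ ℕ₀^d`. -/
abbrev MIdx (d : ℕ) := Fin d → ℕ

variable {d : ℕ}

/-- Degree `|k|` of a multi-index. -/
def mdeg (k : MIdx d) : ℕ := ∑ i, k i

/-- Factorial `k!` of a multi-index. -/
def mfact (k : MIdx d) : ℕ := ∏ i, Nat.factorial (k i)

/-- Monomial `v^k`. -/
def mpow (v : Ed d) (k : MIdx d) : ℝ := ∏ i, (v i) ^ (k i)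

/-- Partial (line) derivative in coordinate `i`. -/
def pd (i : Fin d) (f : Ed d → ℝ) : Ed d → ℝ :=
  fun x => lineDeriv ℝ f x (EuclideanSpace.single i (1:ℝ))

/-- Iterated partial derivative `∂^k`. -/
def mderiv (k : MIdx d) (f : Ed d → ℝ) : Ed d → ℝ :=
  (List.finRange d).foldr (fun i g => (pd i)^[k i] g) f

/-- Smooth compactly supported test function. -/
def IsTest (φ : Ed d → ℝ) : Prop := ContDiff ℝ (⊤ : ℕ∞) φ ∧ HasCompactSupport φ

/-- The `C^r` norm `max_{|k| ≤ r} ‖∂^k φ‖_∞`. -/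
def crNorm (r : ℕ) (φ : Ed d → ℝ) : ℝ :=
  ⨆ k : {k : MIdx d // mdeg k ≤ r}, ⨆ x : Ed d, |mderiv k.1 φ x|

/-- Generalized functions: arbitrary functionals on functions on `ℝ^d`. -/
abbrev DFunc (d : ℕ) := (Ed d → ℝ) → ℝ

/-- `f` is a distribution in `𝒟'(ℝ^d)`: linear on test functions and,
on every compact, bounded by some `C^r` norm. -/
def IsDistribution (f : DFunc d) : Prop :=
  (∀ φ ψ : Ed d → ℝ, IsTest φ → IsTest ψ → f (φ + ψ) = f φ + f ψ) ∧
  (∀ (c : ℝ) (φ : Ed d → ℝ), IsTest φ → f (c • φ) = c * f φ) ∧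
  (∀ K : Set (Ed d), IsCompact K → ∃ (r : ℕ) (C : ℝ),
    ∀ φ : Ed d → ℝ, IsTest φ → tsupport φ ⊆ K → |f φ| ≤ C * crNorm r φ)

/-- `f` is a distribution of order `r` (bound by the `C^r` norm on every compact). -/
def DistOrder (f : DFunc d) (r : ℕ) : Prop :=
  ∀ K : Set (Ed d), IsCompact K → ∃ C : ℝ,
    ∀ φ : Ed d → ℝ, IsTest φ → tsupport φ ⊆ K → |f φ| ≤ C * crNorm r φ

/-- `φ` is of class `C^r`: all iterated coordinate-partials up to order `r`
exist and are continuous. -/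
def IsCr (r : ℕ) (φ : Ed d → ℝ) : Prop :=
  ∀ k : MIdx d, mdeg k ≤ r →
    Continuous (mderiv k φ) ∧
    (mdeg k < r → ∀ (i : Fin d) (x : Ed d),
      LineDifferentiableAt ℝ (mderiv k φ) x (EuclideanSpace.single i (1:ℝ)))

/-- The functional `f` acts canonically (linearly, with local order-`r` bounds) on all
compactly supported `C^r` functions; i.e. `f` incorporates the canonical extension of a
distribution of order `r`. -/
def OrderExt (f : DFunc d) (r : ℕ) : Prop :=
  (∀ φ ψ : Ed d → ℝ, IsCr r φ → HasCompactSupport φ → IsCr r ψ → HasCompactSupport ψ →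
      f (φ + ψ) = f φ + f ψ) ∧
  (∀ (c : ℝ) (φ : Ed d → ℝ), IsCr r φ → HasCompactSupport φ → f (c • φ) = c * f φ) ∧
  (∀ K : Set (Ed d), IsCompact K → ∃ C : ℝ,
    ∀ φ : Ed d → ℝ, IsCr r φ → HasCompactSupport φ → tsupport φ ⊆ K → |f φ| ≤ C * crNorm r φ)

/-- The scaled recentred test function `φ_x^λ(y) = λ^{-d} φ(λ^{-1}(y-x))`. -/
def scTF (φ : Ed d → ℝ) (x : Ed d) (l : ℝ) : Ed d → ℝ :=
  fun y => (l ^ d)⁻¹ * φ (l⁻¹ • (y - x))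

/-- The class `𝓑^r` of smooth test functions supported in the closed unit ball with
all derivatives of order `≤ r` bounded by one. -/
def TB (d r : ℕ) : Set (Ed d → ℝ) :=
  {φ | IsTest φ ∧ tsupport φ ⊆ closedBall (0 : Ed d) 1 ∧
    ∀ k : MIdx d, mdeg k ≤ r → ∀ x, |mderiv k φ x| ≤ 1}

/-- The class `𝓑_γ` of smooth test functions supported in the closed unit ball which
annihilate all monomials of degree `≤ γ`. -/
def TAnn (d : ℕ) (γ : ℝ) : Set (Ed d → ℝ) :=
  {φ | IsTest φ ∧ tsupport φ ⊆ closedBall (0 : Ed d) 1 ∧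
    ∀ k : MIdx d, (mdeg k : ℝ) ≤ γ → (∫ z, φ z * mpow z k) = 0}

/-- The class `𝓑^r_γ = 𝓑^r ∩ 𝓑_γ`. -/
def TBAnn (d r : ℕ) (γ : ℝ) : Set (Ed d → ℝ) := TB d r ∩ TAnn d γ

/-- A germ: a family of functionals indexed by base points. -/
abbrev GermF (d : ℕ) := Ed d → DFunc d

/-- A germ of distributions, measurable in the base point. -/
def IsGerm (F : GermF d) : Prop :=
  (∀ x, IsDistribution (F x)) ∧ ∀ φ : Ed d → ℝ, IsTest φ → Measurable (fun x => F x φ)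

/-- Homogeneity bound with constant `C`: `|F_x(φ_x^λ)| ≤ C λ^ᾱ` on `(K, λ̄)` at order `r`. -/
def HomB (F : GermF d) (a : ℝ) (r : ℕ) (K : Set (Ed d)) (lb C : ℝ) : Prop :=
  ∀ x ∈ K, ∀ l : ℝ, 0 < l → l ≤ lb → ∀ φ ∈ TB d r, |F x (scTF φ x l)| ≤ C * l ^ a

/-- Coherence bound with constant `C`:
`|(F_y - F_x)(φ_x^λ)| ≤ C λ^α (|y-x|+λ)^{γ-α}` on `(K, λ̄)` at order `r`. -/
def CohB (F : GermF d) (a g : ℝ) (r : ℕ) (K : Set (Ed d)) (lb C : ℝ) : Prop :=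
  ∀ x ∈ K, ∀ y ∈ K, ∀ l : ℝ, 0 < l → l ≤ lb → ∀ φ ∈ TB d r,
    |F y (scTF φ x l) - F x (scTF φ x l)| ≤ C * l ^ a * (dist y x + l) ^ (g - a)

/-- `F` is `ᾱ`-homogeneous of order `r`. -/
def Homog (F : GermF d) (a : ℝ) (r : ℕ) : Prop :=
  ∀ K : Set (Ed d), IsCompact K → ∀ lb : ℝ, 1 ≤ lb → ∃ C, HomB F a r K lb C

/-- `F` is `(α, γ)`-coherent of order `r`. -/
def Coh (F : GermF d) (a g : ℝ) (r : ℕ) : Prop :=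
  ∀ K : Set (Ed d), IsCompact K → ∀ lb : ℝ, 1 ≤ lb → ∃ C, CohB F a g r K lb C

/-- Weak homogeneity bound with constant `C` (test functions annihilating polynomials
at small scales, plus a scale-one bound on all of `𝓑^r`). -/
def WHomB (F : GermF d) (a : ℝ) (r : ℕ) (K : Set (Ed d)) (lb C : ℝ) : Prop :=
  (∀ x ∈ K, ∀ l : ℝ, 0 < l → l ≤ lb → ∀ φ ∈ TBAnn d r a,
      |F x (scTF φ x l)| ≤ C * l ^ a) ∧
  (∀ x ∈ K, ∀ ψ ∈ TB d r, |F x (scTF ψ x 1)| ≤ C)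

/-- Weak coherence bound with constant `C`. -/
def WCohB (F : GermF d) (a g : ℝ) (r : ℕ) (K : Set (Ed d)) (lb C : ℝ) : Prop :=
  (∀ x ∈ K, ∀ y ∈ K, ∀ l : ℝ, 0 < l → l ≤ lb → ∀ φ ∈ TBAnn d r g,
      |F y (scTF φ x l) - F x (scTF φ x l)| ≤ C * l ^ a * (dist y x + l) ^ (g - a)) ∧
  (∀ x ∈ K, ∀ y ∈ K, ∀ ψ ∈ TB d r, |F y (scTF ψ x 1) - F x (scTF ψ x 1)| ≤ C)

/-- `F` is weakly `ᾱ`-homogeneous of order `r`. -/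
def WHomog (F : GermF d) (a : ℝ) (r : ℕ) : Prop :=
  ∀ K : Set (Ed d), IsCompact K → ∀ lb : ℝ, 1 ≤ lb → ∃ C, WHomB F a r K lb C

/-- `F` is weakly `(α,γ)`-coherent of order `r`. -/
def WCoh (F : GermF d) (a g : ℝ) (r : ℕ) : Prop :=
  ∀ K : Set (Ed d), IsCompact K → ∀ lb : ℝ, 1 ≤ lb → ∃ C, WCohB F a g r K lb C

/-- The canonical order `r_{ᾱ,α} = min{n ∈ ℕ₀ : n > max(-ᾱ, -α)}`. -/
def rJ (a b : ℝ) : ℕ := (⌊max (-a) (-b)⌋ + 1).toNat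

/-- Joint homogeneity-and-coherence bound at the canonical order. -/
def JointB (F : GermF d) (ab a g : ℝ) (K : Set (Ed d)) (lb C : ℝ) : Prop :=
  HomB F ab (rJ ab a) K lb C ∧ CohB F a g (rJ ab a) K lb C

/-- Joint weak homogeneity-and-coherence bound at the canonical order. -/
def WJointB (F : GermF d) (ab a g : ℝ) (K : Set (Ed d)) (lb C : ℝ) : Prop :=
  WHomB F ab (rJ ab a) K lb C ∧ WCohB F a g (rJ ab a) K lb C

/-- `R` is a `γ`-reconstruction of the `(α,γ)`-coherent germ `F`. -/
def IsRec (F : GermF d) (R : DFunc d) (a g : ℝ) : Prop :=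
  ∀ r : ℕ, -a < (r : ℝ) → ∀ K : Set (Ed d), IsCompact K → ∃ C : ℝ,
    ∀ x ∈ K, ∀ l : ℝ, 0 < l → l ≤ 1 → ∀ φ ∈ TB d r,
      |F x (scTF φ x l) - R (scTF φ x l)| ≤ C * l ^ g

/-- Mixed partial derivative `∂_1^k ∂_2^l K(x,y)` of a kernel. -/
def mixDeriv (k l : MIdx d) (Kf : Ed d → Ed d → ℝ) (x y : Ed d) : ℝ :=
  mderiv k (fun x' => mderiv l (fun y' => Kf x' y') y) x

/-- The kernel `K(x,y)` is of class `C^{m,r}` (mixed partials `∂_1^k ∂_2^l`, `|k| ≤ m`,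
`|l| ≤ r`, exist and are continuous). -/
def IsCmr (m r : ℕ) (Kf : Ed d → Ed d → ℝ) : Prop :=
  ∀ k l : MIdx d, mdeg k ≤ m → mdeg l ≤ r →
    Continuous (fun p : Ed d × Ed d => mixDeriv k l Kf p.1 p.2) ∧
    (mdeg k < m → ∀ (i : Fin d) (x y : Ed d),
      LineDifferentiableAt ℝ (fun x' => mixDeriv k l Kf x' y) x
        (EuclideanSpace.single i (1:ℝ))) ∧
    (mdeg l < r → ∀ (j : Fin d) (x y : Ed d),
      LineDifferentiableAt ℝ (mderiv l (fun y' => Kf x y')) y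
        (EuclideanSpace.single j (1:ℝ)))

/-- `Kn` is the dyadic decomposition of a `β`-regularising kernel of order `(m,r)`
with range `ρ` (Definition 2.3 of the paper). -/
def RegKer (d : ℕ) (β : ℝ) (m r : ℕ) (ρ : ℝ) (Kn : ℕ → Ed d → Ed d → ℝ) : Prop :=
  (∀ n, IsCmr m r (Kn n)) ∧
  (∀ n x y, Kn n x y ≠ 0 → dist x y ≤ ρ * 2 ^ (-(n : ℝ))) ∧
  (∀ K : Set (Ed d), IsCompact K → ∃ c : ℝ, 0 < c ∧
    (∀ n, ∀ k l : MIdx d, mdeg k ≤ m → mdeg l ≤ r → ∀ x ∈ K, ∀ y ∈ K,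
      |mixDeriv k l (Kn n) x y| ≤
        c * 2 ^ ((((d : ℝ) - β + (mdeg l : ℝ) + (mdeg k : ℝ))) * n)) ∧
    (∀ n, ∀ k l : MIdx d, mdeg k ≤ r → mdeg l ≤ r → ∀ y ∈ K,
      |∫ x, mpow (y - x) l * mderiv k (fun y' => Kn n x y') y| ≤ c * 2 ^ (-(β * (n : ℝ)))))

/-- `K_n^* ψ (y) = ∫ ψ(x) K_n(x,y) dx`. -/
def kstar (Kf : Ed d → Ed d → ℝ) (ψ : Ed d → ℝ) : Ed d → ℝ :=
  fun y => ∫ x, ψ x * Kf x y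

/-- `g = 𝖪 f`, i.e. `g(ψ) = Σ_n f(K_n^* ψ)` (with convergence) on test functions. -/
def KInt (Kn : ℕ → Ed d → Ed d → ℝ) (f g : DFunc d) : Prop :=
  ∀ ψ : Ed d → ℝ, IsTest ψ → HasSum (fun n => f (kstar (Kn n) ψ)) (g ψ)

/-- The kernel decomposition preserves polynomials at level `γ`. -/
def PresPoly (Kn : ℕ → Ed d → Ed d → ℝ) (γ : ℝ) : Prop :=
  ∀ n, ∀ k : MIdx d, (mdeg k : ℝ) ≤ γ →
    ∃ p : MvPolynomial (Fin d) ℝ, p.totalDegree ≤ mdeg k ∧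
      ∀ x : Ed d, (∫ y, Kn n x y * mpow y k) = MvPolynomial.eval (fun i => x i) p

/-- Distributional derivative `D^k f (φ) = (-1)^{|k|} f(∂^k φ)`. -/
def distDeriv (k : MIdx d) (f : DFunc d) : DFunc d :=
  fun φ => (-1 : ℝ) ^ (mdeg k) * f (mderiv k φ)

/-- `η ∈ 𝒟` with `∫ η = 1` and vanishing moments of orders `1 ≤ |l| < δ`. -/
def GoodEta (δ : ℝ) (η : Ed d → ℝ) : Prop :=
  IsTest η ∧ (∫ z, η z) = 1 ∧
    ∀ k : MIdx d, 1 ≤ mdeg k → (mdeg k : ℝ) < δ → (∫ z, η z * mpow z k) = 0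

/-- `v` is the pointwise derivative `D^k f(x)`, defined through the limit
`lim_{λ↓0} D^k f(η_x^λ)` for every admissible mollifier `η`. -/
def HasPtDeriv (f : DFunc d) (δ : ℝ) (k : MIdx d) (x : Ed d) (v : ℝ) : Prop :=
  ∀ η : Ed d → ℝ, GoodEta δ η →
    Tendsto (fun l : ℝ => distDeriv k f (scTF η x l)) (nhdsWithin 0 (Set.Ioi 0)) (nhds v)

/-- The Taylor polynomial `Σ_{|k| < δ} c_k (·-x)^k / k!`, viewed as the functional
`ψ ↦ Σ_{|k| < δ} c_k ∫ ψ(y) (y-x)^k / k! dy`. -/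
def taylorF (δ : ℝ) (c : MIdx d → ℝ) (x : Ed d) : DFunc d :=
  fun ψ => ∑ᶠ k ∈ {k : MIdx d | (mdeg k : ℝ) < δ},
    c k * ((∫ y, ψ y * mpow (y - x) k) / (mfact k))

/-- The smallest positive integer `> -γ` (used in Hölder–Zygmund spaces for `γ < 0`). -/
def rNeg (γ : ℝ) : ℕ := (⌊-γ + 1⌋).toNat

/-- The Hölder–Zygmund bound with constant `C` on the compact `K` (with `λ̄ = 1`). -/
def ZBound (γ : ℝ) (f : DFunc d) (K : Set (Ed d)) (C : ℝ) : Prop :=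
  (γ < 0 → ∀ x ∈ K, ∀ l : ℝ, 0 < l → l ≤ 1 → ∀ φ ∈ TB d (rNeg γ),
    |f (scTF φ x l)| ≤ C * l ^ γ) ∧
  (0 ≤ γ →
    (∀ x ∈ K, ∀ ψ ∈ TB d 0, |f (scTF ψ x 1)| ≤ C) ∧
    (∀ x ∈ K, ∀ l : ℝ, 0 < l → l ≤ 1 → ∀ φ ∈ TBAnn d 0 γ,
      |f (scTF φ x l)| ≤ C * l ^ γ))

/-- Membership in the local Hölder–Zygmund space `𝒵^γ`. -/
def MemZ (γ : ℝ) (f : DFunc d) : Prop :=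
  IsDistribution f ∧ ∀ K : Set (Ed d), IsCompact K → ∃ C, ZBound γ f K C

/-- `(Pg, Gg)` is a model with homogeneities `α` of order `rP`, with index set `S`. -/
def IsModelOn {ι : Type} (S : Finset ι) (Pg : ι → GermF d)
    (Gg : ι → ι → Ed d → Ed d → ℝ) (α : ι → ℝ) (rP : ℕ) : Prop :=
  (∀ i ∈ S, IsGerm (Pg i)) ∧
  (∀ i ∈ S, Homog (Pg i) (α i) rP) ∧
  (∀ i ∈ S, ∀ x y : Ed d, ∀ φ : Ed d → ℝ, IsTest φ →
    Pg i y φ = ∑ j ∈ S, Pg j x φ * Gg j i x y)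

/-- The modelled-distribution bound with constant `C` on the compact `K`. -/
def MDB {ι : Type} (S : Finset ι) (Gg : ι → ι → Ed d → Ed d → ℝ) (α : ι → ℝ)
    (γ : ℝ) (f : Ed d → ι → ℝ) (K : Set (Ed d)) (C : ℝ) : Prop :=
  (∀ x ∈ K, ∀ i ∈ S, |f x i| ≤ C) ∧
  (∀ x ∈ K, ∀ y ∈ K, ∀ i ∈ S,
    |(∑ j ∈ S, Gg i j x y * f y j) - f x i| ≤ C * (dist y x) ^ (γ - α i))

/-- `f` is a modelled distribution of order `γ` relative to the model data. -/
def IsMD {ι : Type} (S : Finset ι) (Gg : ι → ι → Ed d → Ed d → ℝ) (α : ι → ℝ)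
    (γ : ℝ) (f : Ed d → ι → ℝ) : Prop :=
  (∀ i ∈ S, Measurable fun x : Ed d => f x i) ∧
  ∀ K : Set (Ed d), IsCompact K → ∃ C, MDB S Gg α γ f K C

/-- The germ `⟨f, Π⟩_x = Σ_i f^i(x) Π^i_x`. -/
def germOf {ι : Type} (S : Finset ι) (Pg : ι → GermF d) (f : Ed d → ι → ℝ) : GermF d :=
  fun x φ => ∑ i ∈ S, f x i * Pg i x φ

/-! ### Helper lemmas -/

/-- Test functions supported in the closed unit ball. -/
def TU (φ : Ed d → ℝ) : Prop := IsTest φ ∧ tsupport φ ⊆ closedBall (0 : Ed d) 1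

/-- The moment of `φ` of index `k`. -/
def mom (φ : Ed d → ℝ) (k : MIdx d) : ℝ := ∫ z, φ z * mpow z k

lemma mpow_contDiff (k : MIdx d) : ContDiff ℝ (⊤ : ℕ∞) (fun z : Ed d => mpow z k) := by
  unfold mpow
  fun_prop

lemma IsTest.add {φ ψ : Ed d → ℝ} (h : IsTest φ) (h' : IsTest ψ) : IsTest (φ + ψ) :=
  ⟨h.1.add h'.1, h.2.add h'.2⟩

lemma IsTest.smul {φ : Ed d → ℝ} (c : ℝ) (h : IsTest φ) : IsTest (c • φ) :=
  ⟨contDiff_const.smul h.1, h.2.smul_left (f := fun _ => c)⟩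

lemma IsTest.zero : IsTest (0 : Ed d → ℝ) :=
  ⟨contDiff_const, HasCompactSupport.zero⟩

lemma TU.add {φ ψ : Ed d → ℝ} (h : TU φ) (h' : TU ψ) : TU (φ + ψ) :=
  ⟨h.1.add h'.1, (tsupport_add φ ψ).trans (Set.union_subset h.2 h'.2)⟩

lemma TU.smul {φ : Ed d → ℝ} (c : ℝ) (h : TU φ) : TU (c • φ) :=
  ⟨h.1.smul c, (tsupport_smul_subset_right (fun _ => c) φ).trans h.2⟩

lemma TU.zero : TU (0 : Ed d → ℝ) := ⟨IsTest.zero, by simp⟩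

lemma TU.sum {ι : Type*} (s : Finset ι) (g : ι → Ed d → ℝ) (h : ∀ i ∈ s, TU (g i)) :
    TU (∑ i ∈ s, g i) := by
  induction s using Finset.induction_on with
  | empty => simpa using TU.zero
  | insert a s ha ih =>
    rw [Finset.sum_insert ha]
    exact (h a (by simp)).add (ih fun i hi => h i (by simp [hi]))

lemma pd_eq {φ : Ed d → ℝ} (h : IsTest φ) (i : Fin d) :
    pd i φ = fun x => fderiv ℝ φ x (EuclideanSpace.single i (1:ℝ)) := by
  funext x
  exact (h.1.differentiable (by simp) x).lineDeriv_eq_fderiv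

lemma IsTest.pd {φ : Ed d → ℝ} (h : IsTest φ) (i : Fin d) : IsTest (pd i φ) := by
  rw [pd_eq h]
  refine ⟨?_, h.2.fderiv_apply ℝ _⟩
  exact (h.1.fderiv_right (m := (⊤ : ℕ∞)) (by simp)).clm_apply contDiff_const

lemma pd_tsupport {φ : Ed d → ℝ} (h : IsTest φ) (i : Fin d) : tsupport (pd i φ) ⊆ tsupport φ := by
  rw [pd_eq h]
  exact tsupport_fderiv_apply_subset ℝ _

lemma mderiv_list_ind {P : (Ed d → ℝ) → Prop} (hP : ∀ g i, P g → P (pd i g)) (k : MIdx d)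
    (L : List (Fin d)) {g : Ed d → ℝ} (hg : P g) :
    P (L.foldr (fun i g => (pd i)^[k i] g) g) := by
  induction L with
  | nil => simpa using hg
  | cons i L ih =>
    simp only [List.foldr_cons]
    generalize k i = n
    induction n with
    | zero => simpa using ih
    | succ n ih2 => rw [Function.iterate_succ_apply']; exact hP _ _ ih2

lemma mderiv_ind {P : (Ed d → ℝ) → Prop} (hP : ∀ g i, P g → P (pd i g)) (k : MIdx d)
    {g : Ed d → ℝ} (hg : P g) : P (mderiv k g) := mderiv_list_ind hP k _ hg

lemma IsTest.mderiv {φ : Ed d → ℝ} (h : IsTest φ) (k : MIdx d) : IsTest (mderiv k φ) :=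
  mderiv_ind (P := IsTest) (fun _ i hg => hg.pd i) k h

lemma TU.pd {φ : Ed d → ℝ} (h : TU φ) (i : Fin d) : TU (pd i φ) :=
  ⟨h.1.pd i, (pd_tsupport h.1 i).trans h.2⟩

lemma TU.mderiv {φ : Ed d → ℝ} (h : TU φ) (k : MIdx d) : TU (mderiv k φ) :=
  mderiv_ind (P := TU) (fun _ i hg => hg.pd i) k h

lemma pd_smul (c : ℝ) (φ : Ed d → ℝ) (i : Fin d) : pd i (c • φ) = c • pd i φ := by
  funext x
  simp only [pd, lineDeriv, Pi.smul_apply, smul_eq_mul]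
  rw [deriv_const_mul_field]

lemma pd_add {φ ψ : Ed d → ℝ} (h : IsTest φ) (h' : IsTest ψ) (i : Fin d) :
    pd i (φ + ψ) = pd i φ + pd i ψ := by
  rw [pd_eq h, pd_eq h', pd_eq (h.add h')]
  funext x
  rw [fderiv_add (h.1.differentiable (by simp) x) (h'.1.differentiable (by simp) x)]
  rfl

lemma pd_scTF (φ : Ed d → ℝ) (x : Ed d) (l : ℝ) (i : Fin d) :
    pd i (scTF φ x l) = l⁻¹ • scTF (pd i φ) x l := by
  funext y
  simp only [pd, lineDeriv, Pi.smul_apply, smul_eq_mul, scTF]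
  rw [deriv_const_mul_field]
  have : (fun t : ℝ => φ (l⁻¹ • (y + t • EuclideanSpace.single i (1:ℝ) - x)))
      = fun t : ℝ => (fun s : ℝ => φ (l⁻¹ • (y - x) + s • EuclideanSpace.single i (1:ℝ))) (l⁻¹ * t) := by
    funext t
    congr 1
    module
  rw [this, deriv_comp_mul_left l⁻¹
    (fun s : ℝ => φ (l⁻¹ • (y - x) + s • EuclideanSpace.single i (1:ℝ))) 0]
  simp only [mul_zero, smul_eq_mul]
  ring

lemma iter_smul (c : ℝ) (φ : Ed d → ℝ) (i : Fin d) (n : ℕ) :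
    (pd i)^[n] (c • φ) = c • (pd i)^[n] φ := by
  induction n with
  | zero => rfl
  | succ n ih => rw [Function.iterate_succ_apply', ih, pd_smul, Function.iterate_succ_apply']

lemma iter_scTF (φ : Ed d → ℝ) (x : Ed d) (l : ℝ) (i : Fin d) (n : ℕ) :
    (pd i)^[n] (scTF φ x l) = (l⁻¹) ^ n • scTF ((pd i)^[n] φ) x l := by
  induction n with
  | zero => simp
  | succ n ih =>
    rw [Function.iterate_succ_apply', ih, pd_smul, Function.iterate_succ_apply', pd_scTF, smul_smul,
      pow_succ]

lemma mdeg_list (k : MIdx d) : ((List.finRange d).map k).sum = mdeg k := by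
  unfold mdeg
  rw [← List.sum_ofFn, List.ofFn_eq_map]

lemma mderiv_smul (k : MIdx d) (c : ℝ) (φ : Ed d → ℝ) : mderiv k (c • φ) = c • mderiv k φ := by
  unfold mderiv
  induction List.finRange d with
  | nil => rfl
  | cons i L ih => simp only [List.foldr_cons]; rw [ih, iter_smul]

lemma mderiv_scTF (k : MIdx d) (φ : Ed d → ℝ) (x : Ed d) (l : ℝ) :
    mderiv k (scTF φ x l) = (l⁻¹) ^ (mdeg k) • scTF (mderiv k φ) x l := by
  rw [← mdeg_list]
  unfold mderiv
  induction List.finRange d with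
  | nil => simp
  | cons i L ih =>
    simp only [List.foldr_cons, List.map_cons, List.sum_cons]
    rw [ih, iter_smul, iter_scTF, smul_smul, pow_add, mul_comm]

lemma iter_test {φ : Ed d → ℝ} (h : IsTest φ) (i : Fin d) (n : ℕ) : IsTest ((pd i)^[n] φ) := by
  induction n with
  | zero => exact h
  | succ n ih => rw [Function.iterate_succ_apply']; exact ih.pd i

lemma iter_add {φ ψ : Ed d → ℝ} (h : IsTest φ) (h' : IsTest ψ) (i : Fin d) (n : ℕ) :
    (pd i)^[n] (φ + ψ) = (pd i)^[n] φ + (pd i)^[n] ψ := by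
  induction n with
  | zero => rfl
  | succ n ih =>
    simp only [Function.iterate_succ_apply']
    rw [ih, pd_add (iter_test h i n) (iter_test h' i n)]

lemma mderiv_add (k : MIdx d) {φ ψ : Ed d → ℝ} (h : IsTest φ) (h' : IsTest ψ) :
    mderiv k (φ + ψ) = mderiv k φ + mderiv k ψ := by
  unfold mderiv
  induction List.finRange d with
  | nil => rfl
  | cons i L ih =>
    simp only [List.foldr_cons]
    rw [ih, iter_add]
    · exact mderiv_list_ind (P := IsTest) (fun _ i hg => hg.pd i) k L h
    · exact mderiv_list_ind (P := IsTest) (fun _ i hg => hg.pd i) k L h'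

/-! scaling -/

lemma scTF_scTF (φ : Ed d → ℝ) (x : Ed d) (s l : ℝ) :
    scTF (scTF φ 0 s) x l = scTF φ x (s * l) := by
  funext y
  simp only [scTF, sub_zero, smul_smul, mul_inv, mul_pow]
  ring

lemma scTF_add (φ ψ : Ed d → ℝ) (x : Ed d) (l : ℝ) :
    scTF (φ + ψ) x l = scTF φ x l + scTF ψ x l := by
  funext y
  simp only [scTF, Pi.add_apply]
  ring

lemma scTF_smul (c : ℝ) (φ : Ed d → ℝ) (x : Ed d) (l : ℝ) :
    scTF (c • φ) x l = c • scTF φ x l := by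
  funext y
  simp only [scTF, Pi.smul_apply, smul_eq_mul]
  ring

lemma scTF_tsupport {φ : Ed d → ℝ} {R : ℝ} (h : tsupport φ ⊆ closedBall (0 : Ed d) R) (x : Ed d)
    {l : ℝ} (hl : 0 < l) : tsupport (scTF φ x l) ⊆ closedBall x (l * R) := by
  refine closure_minimal ?_ isClosed_closedBall
  intro y hy
  have hy' : φ (l⁻¹ • (y - x)) ≠ 0 := by
    intro h0
    apply hy
    simp [scTF, h0]
  have := h (subset_tsupport _ hy')
  rw [mem_closedBall_zero_iff, norm_smul, norm_inv, Real.norm_of_nonneg hl.le, inv_mul_le_iff₀ hl]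
    at this
  rwa [mem_closedBall, dist_eq_norm]

lemma IsTest.scTF {φ : Ed d → ℝ} (h : IsTest φ) (x : Ed d) {l : ℝ} (hl : 0 < l) :
    IsTest (scTF φ x l) := by
  refine ⟨?_, ?_⟩
  · have := h.1
    unfold _root_.scTF
    fun_prop
  · obtain ⟨R, hR⟩ := h.2.isCompact.isBounded.subset_closedBall (0 : Ed d)
    exact (isCompact_closedBall x (l * R)).of_isClosed_subset (isClosed_tsupport _)
      (scTF_tsupport hR x hl)

lemma TU.scTF {φ : Ed d → ℝ} (h : TU φ) {s : ℝ} (hs : 0 < s) (hs1 : s ≤ 1) :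
    TU (scTF φ 0 s) :=
  ⟨h.1.scTF 0 hs, (scTF_tsupport h.2 0 hs).trans (closedBall_subset_closedBall (by linarith))⟩

/-! moments -/

lemma integ_mom {φ : Ed d → ℝ} (h : IsTest φ) (k : MIdx d) :
    Integrable (fun z => φ z * mpow z k) :=
  (h.1.continuous.mul (mpow_contDiff k).continuous).integrable_of_hasCompactSupport h.2.mul_right

lemma mom_add {φ ψ : Ed d → ℝ} (h : IsTest φ) (h' : IsTest ψ) (k : MIdx d) :
    mom (φ + ψ) k = mom φ k + mom ψ k := by
  unfold mom
  rw [← integral_add (integ_mom h k) (integ_mom h' k)]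
  congr 1
  funext z
  simp [add_mul]

lemma mom_smul (c : ℝ) (φ : Ed d → ℝ) (k : MIdx d) : mom (c • φ) k = c * mom φ k := by
  unfold mom
  rw [← integral_const_mul]
  congr 1
  funext z
  simp [mul_assoc]

lemma mom_zero (k : MIdx d) : mom (0 : Ed d → ℝ) k = 0 := by simp [mom]

lemma mom_sum {ι : Type*} (s : Finset ι) (g : ι → Ed d → ℝ) (h : ∀ i ∈ s, TU (g i)) (k : MIdx d) :
    mom (∑ i ∈ s, g i) k = ∑ i ∈ s, mom (g i) k := by
  induction s using Finset.induction_on with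
  | empty => simp [mom_zero]
  | insert a s ha ih =>
    rw [Finset.sum_insert ha, Finset.sum_insert ha, mom_add (h a (by simp)).1
      (TU.sum s g fun i hi => h i (by simp [hi])).1, ih fun i hi => h i (by simp [hi])]

lemma mpow_smul (c : ℝ) (z : Ed d) (k : MIdx d) : mpow (c • z) k = c ^ mdeg k * mpow z k := by
  simp [mpow, mdeg, mul_pow, Finset.prod_mul_distrib, Finset.prod_pow_eq_pow_sum]

lemma mom_scTF_gen (φ : Ed d → ℝ) (x : Ed d) {l : ℝ} (hl : 0 < l) (k : MIdx d) :
    ∫ y, scTF φ x l y * mpow (y - x) k = l ^ mdeg k * mom φ k := by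
  have h1 : ∫ y, scTF φ x l y * mpow (y - x) k
      = ∫ y, (fun w => (l ^ d)⁻¹ * φ (l⁻¹ • w) * mpow w k) (y - x) := rfl
  rw [h1, integral_sub_right_eq_self (fun w : Ed d => (l ^ d)⁻¹ * φ (l⁻¹ • w) * mpow w k) x]
  have h2 : (fun w : Ed d => (l ^ d)⁻¹ * φ (l⁻¹ • w) * mpow w k)
      = fun w => (fun z => (l ^ d)⁻¹ * l ^ mdeg k * (φ z * mpow z k)) (l⁻¹ • w) := by
    funext w
    simp only [mpow_smul]
    have : l ^ mdeg k * l⁻¹ ^ mdeg k = 1 := by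
      rw [← mul_pow, mul_inv_cancel₀ hl.ne', one_pow]
    linear_combination (-((l ^ d)⁻¹ * φ (l⁻¹ • w) * mpow w k)) * this
  rw [h2, Measure.integral_comp_inv_smul_of_nonneg volume
    (fun z : Ed d => (l ^ d)⁻¹ * l ^ mdeg k * (φ z * mpow z k)) hl.le, integral_const_mul]
  simp only [finrank_euclideanSpace, Fintype.card_fin, smul_eq_mul, mom]
  have : l ^ d ≠ 0 := by positivity
  field_simp

lemma mom_scTF (φ : Ed d → ℝ) {l : ℝ} (hl : 0 < l) (k : MIdx d) :
    mom (scTF φ 0 l) k = l ^ mdeg k * mom φ k := by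
  rw [← mom_scTF_gen φ 0 hl k]
  simp [mom]

/-- lower the `i`-th entry of a multi-index by `n`. -/
def low (l : MIdx d) (i : Fin d) (n : ℕ) : MIdx d := Function.update l i (l i - n)

lemma hasFDeriv_mpow (l : MIdx d) (i : Fin d) (z : Ed d) :
    fderiv ℝ (fun z : Ed d => mpow z l) z (EuclideanSpace.single i (1:ℝ))
      = l i * mpow z (low l i 1) := by
  have hd : DifferentiableAt ℝ (fun z : Ed d => mpow z l) z :=
    (mpow_contDiff l).differentiable (by simp) z
  rw [← hd.lineDeriv_eq_fderiv]
  have h2 : (fun t : ℝ => mpow (z + t • EuclideanSpace.single i (1:ℝ)) l)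
      = fun t => (∏ j ∈ Finset.univ.erase i, (z j) ^ (l j)) * (z i + t) ^ (l i) := by
    funext t
    unfold mpow
    rw [← Finset.prod_erase_mul _ _ (Finset.mem_univ i)]
    congr 1
    · refine Finset.prod_congr rfl fun j hj => ?_
      have : j ≠ i := (Finset.mem_erase.1 hj).1
      simp [this]
    · simp
  unfold lineDeriv
  rw [h2, deriv_const_mul_field]
  have h3 : HasDerivAt (fun t : ℝ => (z i + t) ^ (l i)) (l i * z i ^ (l i - 1)) 0 := by
    have h4 : HasDerivAt (fun t : ℝ => z i + t) 1 0 := (hasDerivAt_id (0:ℝ)).const_add _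
    have h5 := h4.fun_pow (l i)
    simpa using h5
  rw [h3.deriv]
  unfold mpow
  rw [← Finset.prod_erase_mul _ _ (Finset.mem_univ i)]
  have : ∏ j ∈ Finset.univ.erase i, (z j) ^ (low l i 1 j) = ∏ j ∈ Finset.univ.erase i, (z j) ^ (l j) := by
    refine Finset.prod_congr rfl fun j hj => ?_
    have : j ≠ i := (Finset.mem_erase.1 hj).1
    simp [low, this]
  rw [this]
  simp [low]
  ring

lemma mom_pd {φ : Ed d → ℝ} (h : IsTest φ) (i : Fin d) (l : MIdx d) :
    mom (pd i φ) l = - (l i * mom φ (low l i 1)) := by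
  have hφ := h.1
  have hp := pd_eq h i
  have key := integral_mul_fderiv_eq_neg_fderiv_mul_of_integrable (𝕜 := ℝ) (μ := (volume : Measure (Ed d)))
    (f := φ) (g := fun z : Ed d => mpow z l) (v := EuclideanSpace.single i (1:ℝ))
    (by
      have := integ_mom (h.pd i) l
      rwa [hp] at this)
    (by
      simp only [hasFDeriv_mpow]
      have := (integ_mom h (low l i 1)).const_mul (l i : ℝ)
      refine this.congr (Filter.Eventually.of_forall fun z => ?_)
      simp only; ring)
    (integ_mom h l)
    (fun x _ => hφ.differentiable (by simp) x)
    (fun x _ => (mpow_contDiff l).differentiable (by simp) x)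
  simp only [hasFDeriv_mpow] at key
  unfold mom
  rw [hp]
  rw [eq_neg_iff_add_eq_zero, ← integral_const_mul]
  rw [eq_neg_iff_add_eq_zero] at key
  rw [← key, add_comm]
  congr 2
  funext z
  ring

lemma mom_iter {φ : Ed d → ℝ} (h : IsTest φ) (i : Fin d) (n : ℕ) (l : MIdx d) :
    mom ((pd i)^[n] φ) l = (-1) ^ n * ((l i).descFactorial n) * mom φ (low l i n) := by
  induction n generalizing l with
  | zero => simp [low]
  | succ n ih =>
    rw [Function.iterate_succ_apply', mom_pd (iter_test h i n), ih]
    have h1 : low (low l i 1) i n = low l i (n+1) := by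
      simp [low, Nat.sub_sub, add_comm]
    have h2 : (l i).descFactorial (n+1) = l i * (l i - 1).descFactorial n := by
      cases l i with
      | zero => simp
      | succ m => rw [Nat.succ_descFactorial_succ]; rfl
    rw [h1, h2]
    simp [low]
    ring

lemma mom_list {φ : Ed d → ℝ} (h : IsTest φ) (k : MIdx d) (L : List (Fin d)) (hL : L.Nodup)
    (l : MIdx d) :
    mom (L.foldr (fun i g => (pd i)^[k i] g) φ) l
      = (-1) ^ (L.map k).sum * (L.map fun i => ((l i).descFactorial (k i) : ℝ)).prod *
        mom φ (fun i => if i ∈ L then l i - k i else l i) := by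
  induction L generalizing l with
  | nil => simp
  | cons i L ih =>
    have hi : i ∉ L := (List.nodup_cons.1 hL).1
    simp only [List.foldr_cons, List.map_cons, List.sum_cons, List.prod_cons]
    rw [mom_iter (mderiv_list_ind (P := IsTest) (fun _ i hg => hg.pd i) k L h),
      ih (List.nodup_cons.1 hL).2]
    have h1 : (L.map fun j => ((low l i (k i) j).descFactorial (k j) : ℝ))
        = L.map fun j => ((l j).descFactorial (k j) : ℝ) := by
      refine List.map_congr_left fun j hj => ?_
      have : j ≠ i := fun e => hi (e ▸ hj)
      simp [low, this]
    have h2 : (fun j => if j ∈ L then low l i (k i) j - k j else low l i (k i) j)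
        = fun j => if j ∈ i :: L then l j - k j else l j := by
      funext j
      by_cases hji : j = i
      · subst hji; simp [hi, low]
      · simp [low, hji]
    rw [h1, h2, pow_add]
    ring

lemma mom_mderiv {φ : Ed d → ℝ} (h : IsTest φ) (k l : MIdx d) :
    mom (mderiv k φ) l
      = (-1) ^ mdeg k * (∏ i, ((l i).descFactorial (k i) : ℝ)) * mom φ (fun i => l i - k i) := by
  have := mom_list h k (List.finRange d) (List.nodup_finRange d) l
  rw [mdeg_list] at this
  unfold mderiv
  rw [this]
  rw [← List.prod_ofFn, List.ofFn_eq_map]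
  simp

lemma mdeg_sub_le (l k : MIdx d) : mdeg (fun i => l i - k i) ≤ mdeg l :=
  Finset.sum_le_sum fun i _ => Nat.sub_le _ _

lemma mdeg_zero : mdeg (0 : MIdx d) = 0 := by simp [mdeg]

lemma mdeg_eq_zero {k : MIdx d} (h : mdeg k = 0) : k = 0 := by
  funext i
  simpa using (Finset.sum_eq_zero_iff.1 h) i (Finset.mem_univ i)

lemma finite_mdeg (N : ℕ) : {k : MIdx d | mdeg k ≤ N}.Finite := by
  refine (Set.finite_Iic (fun _ : Fin d => N)).subset fun k hk i => ?_
  exact (Finset.single_le_sum (f := k) (fun _ _ => Nat.zero_le _) (Finset.mem_univ i)).trans hk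

lemma mom_mderiv_zero_le {φ : Ed d → ℝ} (h : IsTest φ) (k : MIdx d) {γ : ℝ}
    (h0 : ∀ l : MIdx d, (mdeg l : ℝ) ≤ γ → mom φ l = 0) :
    ∀ l : MIdx d, (mdeg l : ℝ) ≤ γ → mom (mderiv k φ) l = 0 := by
  intro l hl
  rw [mom_mderiv h, h0 _ (le_trans (by exact_mod_cast mdeg_sub_le l k) hl), mul_zero]

lemma mom_mderiv_zero_lt {φ : Ed d → ℝ} (h : IsTest φ) (k : MIdx d) {γ : ℝ}
    (h0 : ∀ l : MIdx d, (mdeg l : ℝ) < γ → mom φ l = 0) :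
    ∀ l : MIdx d, (mdeg l : ℝ) < γ → mom (mderiv k φ) l = 0 := by
  intro l hl
  rw [mom_mderiv h, h0 _ (lt_of_le_of_lt (by exact_mod_cast mdeg_sub_le l k) hl), mul_zero]

lemma mom_eta {η : Ed d → ℝ} (h : IsTest η) (h1 : mom η 0 = 1) {γ : ℝ}
    (h0 : ∀ l : MIdx d, 1 ≤ mdeg l → (mdeg l : ℝ) ≤ γ → mom η l = 0) (k l : MIdx d)
    (hl : (mdeg l : ℝ) ≤ γ) :
    mom (mderiv k η) l = if l = k then (-1) ^ mdeg k * (mfact k : ℝ) else 0 := by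
  rw [mom_mderiv h]
  split_ifs with hlk
  · subst hlk
    have : (fun i => l i - l i) = (0 : MIdx d) := by funext i; simp
    rw [this, h1, mul_one]
    simp [mfact, Nat.descFactorial_self]
  · by_cases hle : ∀ i, k i ≤ l i
    · have : mdeg (fun i => l i - k i) ≠ 0 := by
        intro h2
        apply hlk
        have h3 := mdeg_eq_zero h2
        funext i
        have h4 := congrFun h3 i
        have := hle i
        simp at h4
        omega
      rw [h0 _ (Nat.one_le_iff_ne_zero.2 this)
        (le_trans (by exact_mod_cast mdeg_sub_le l k) hl), mul_zero]
    · push Not at hle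
      obtain ⟨i, hi⟩ := hle
      have : ∏ i, ((l i).descFactorial (k i) : ℝ) = 0 :=
        Finset.prod_eq_zero (Finset.mem_univ i) (by simp [Nat.descFactorial_eq_zero_iff_lt.2 hi])
      rw [this]
      ring

lemma mom_zero_idx (φ : Ed d → ℝ) : mom φ 0 = ∫ z, φ z := by simp [mom, mpow]

lemma exists_eta (d N : ℕ) : ∃ η : Ed d → ℝ, TU η ∧ mom η 0 = 1 ∧
    ∀ l : MIdx d, 1 ≤ mdeg l → mdeg l ≤ N → mom η l = 0 := by
  induction N with
  | zero =>
    let b : ContDiffBump (0 : Ed d) := ⟨1/2, 1, by norm_num, by norm_num⟩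
    refine ⟨b.normed volume, ⟨⟨b.contDiff_normed, b.hasCompactSupport_normed⟩, ?_⟩, ?_, ?_⟩
    · rw [b.tsupport_normed_eq]
    · rw [mom_zero_idx, b.integral_normed]
    · intro l h1 h2
      omega
  | succ N ih =>
    obtain ⟨η, hη, h1, h0⟩ := ih
    have hs : TU (scTF η 0 (1/2)) := hη.scTF (by norm_num) (by norm_num)
    have hp : (2:ℝ) ^ (N+1) - 1 ≠ 0 := by
      have : (1:ℝ) < 2 ^ (N+1) := one_lt_pow₀ (by norm_num) (by simp)
      linarith
    have hm : ∀ l : MIdx d, mom (((2:ℝ) ^ (N+1) - 1)⁻¹ • ((2:ℝ) ^ (N+1) • scTF η 0 (1/2) + (-1:ℝ) • η)) l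
        = ((2:ℝ) ^ (N+1) - 1)⁻¹ * ((2:ℝ) ^ (N+1) * ((1/2) ^ mdeg l * mom η l) - mom η l) := by
      intro l
      rw [mom_smul, mom_add (hs.smul _).1 (hη.smul _).1, mom_smul, mom_smul,
        mom_scTF _ (by norm_num)]
      ring
    refine ⟨((2:ℝ) ^ (N+1) - 1)⁻¹ • ((2:ℝ) ^ (N+1) • scTF η 0 (1/2) + (-1:ℝ) • η),
      ((hs.smul _).add (hη.smul _)).smul _, ?_, ?_⟩
    · rw [hm, h1, mdeg_zero]
      field_simp
    · intro l hl1 hl2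
      rw [hm]
      rcases Nat.lt_or_ge N (mdeg l) with h | h
      · have : mdeg l = N + 1 := by omega
        rw [this, ← mul_assoc, ← mul_pow]
        norm_num
      · rw [h0 l hl1 h]; ring

/-! distributions -/

lemma f_sum {f : DFunc d} (hf : IsDistribution f) {ι : Type*} (s : Finset ι) (g : ι → Ed d → ℝ)
    (h : ∀ i ∈ s, IsTest (g i)) : IsTest (∑ i ∈ s, g i) ∧ f (∑ i ∈ s, g i) = ∑ i ∈ s, f (g i) := by
  induction s using Finset.induction_on with
  | empty =>
    refine ⟨by simpa using IsTest.zero, ?_⟩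
    have := hf.2.1 0 0 IsTest.zero
    simpa using this
  | insert a s ha ih =>
    obtain ⟨i1, i2⟩ := ih fun i hi => h i (by simp [hi])
    rw [Finset.sum_insert ha, Finset.sum_insert ha, hf.1 _ _ (h a (by simp)) i1, i2]
    exact ⟨(h a (by simp)).add i1, rfl⟩

lemma scTF_sum {ι : Type*} (s : Finset ι) (g : ι → Ed d → ℝ) (x : Ed d) (l : ℝ) :
    scTF (∑ i ∈ s, g i) x l = ∑ i ∈ s, scTF (g i) x l := by
  funext y
  simp [scTF, Finset.mul_sum, Finset.sum_apply]

lemma distDeriv_scTF {f : DFunc d} (hf : IsDistribution f) {φ : Ed d → ℝ} (h : IsTest φ)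
    (k : MIdx d) (x : Ed d) {l : ℝ} (hl : 0 < l) :
    distDeriv k f (scTF φ x l) = (-1) ^ mdeg k * (l⁻¹ ^ mdeg k * f (scTF (mderiv k φ) x l)) := by
  unfold distDeriv
  rw [mderiv_scTF, hf.2.1 _ _ ((h.mderiv k).scTF x hl)]

lemma distDeriv_sub {f : DFunc d} (hf : IsDistribution f) {φ ψ : Ed d → ℝ} (h : IsTest φ)
    (h' : IsTest ψ) (k : MIdx d) :
    distDeriv k f (φ + (-1:ℝ) • ψ) = distDeriv k f φ - distDeriv k f ψ := by
  unfold distDeriv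
  rw [mderiv_add k h (h'.smul _), mderiv_smul, hf.1 _ _ (h.mderiv k) ((h'.mderiv k).smul _),
    hf.2.1 _ _ (h'.mderiv k)]
  ring

/-- local boundedness in the scale -/
lemma bdd_scale {f : DFunc d} (hf : IsDistribution f) {φ : Ed d → ℝ} (h : TU φ) (x : Ed d) :
    ∃ B : ℝ, 0 ≤ B ∧ ∀ l : ℝ, 1/2 ≤ l → l ≤ 1 → |f (scTF φ x l)| ≤ B := by
  obtain ⟨r, C, hC⟩ := hf.2.2 (closedBall x 1) (isCompact_closedBall x 1)
  have hb : ∀ k : MIdx d, ∃ b : ℝ, ∀ y, |mderiv k φ y| ≤ b := by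
    intro k
    obtain ⟨b, hb⟩ := (h.1.mderiv k).2.exists_bound_of_continuous (h.1.mderiv k).1.continuous
    exact ⟨b, hb⟩
  choose b hb using hb
  have hb0 : ∀ k, 0 ≤ b k := fun k => (abs_nonneg _).trans (hb k 0)
  let S := (finite_mdeg (d := d) r).toFinset
  let M : ℝ := (2:ℝ) ^ r * (2 ^ d * ∑ k ∈ S, b k)
  have hM : 0 ≤ M := by
    have := Finset.sum_nonneg fun k (_ : k ∈ S) => hb0 k
    positivity
  refine ⟨|C| * M, by positivity, fun l h1 h2 => ?_⟩
  have hl : 0 < l := by linarith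
  have hli : l⁻¹ ≤ 2 := by
    rw [inv_le_comm₀ hl (by norm_num)]; linarith
  have hli0 : 0 < l⁻¹ := by positivity
  have hcr : crNorm r (scTF φ x l) ≤ M := by
    unfold crNorm
    refine Real.iSup_le (fun k => Real.iSup_le (fun y => ?_) hM) hM
    rw [mderiv_scTF]
    simp only [Pi.smul_apply, scTF, smul_eq_mul, abs_mul, abs_pow, abs_inv, abs_of_pos hl]
    rw [← inv_pow]
    have hk : b k.1 ≤ ∑ k ∈ S, b k :=
      Finset.single_le_sum (fun k _ => hb0 k) (by simpa [S] using k.2)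
    have e1 : l⁻¹ ^ mdeg k.1 ≤ (2:ℝ) ^ r :=
      (pow_le_pow_left₀ hli0.le hli _).trans (pow_le_pow_right₀ (by norm_num) k.2)
    have e2 : l⁻¹ ^ d ≤ (2:ℝ) ^ d := pow_le_pow_left₀ hli0.le hli _
    have e3 := (hb k.1 (l⁻¹ • (y - x))).trans hk
    refine mul_le_mul e1 (mul_le_mul e2 e3 (abs_nonneg _) (by positivity)) (by positivity)
      (by positivity)
  have hcr0 : 0 ≤ crNorm r (scTF φ x l) :=
    Real.iSup_nonneg fun k => Real.iSup_nonneg fun y => abs_nonneg _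
  calc |f (scTF φ x l)| ≤ C * crNorm r (scTF φ x l) :=
        hC _ (h.1.scTF x hl) ((scTF_tsupport h.2 x hl).trans
          (closedBall_subset_closedBall (by linarith)))
    _ ≤ |C| * crNorm r (scTF φ x l) := by gcongr; exact le_abs_self C
    _ ≤ |C| * M := by gcongr

/-! real analysis -/

/-- weak contraction under dyadic rescaling implies power decay -/
lemma decay_of_contract (a : ℝ → ℝ) (s q B C : ℝ) (hs : 0 < s) (hq0 : 0 ≤ q) (hq : q * 2 ^ s < 1)
    (hB : ∀ l, 1/2 ≤ l → l ≤ 1 → |a l| ≤ B)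
    (hC : ∀ l, 0 < l → l ≤ 1 → |a (l/2) - q * a l| ≤ C * l ^ s) :
    ∃ M : ℝ, ∀ l, 0 < l → l ≤ 1 → |a l| ≤ M * l ^ s := by
  have h2s : (0:ℝ) < 2 ^ s := by positivity
  have hC0 : 0 ≤ C := by
    have := (abs_nonneg _).trans (hC 1 one_pos le_rfl)
    simpa using this
  have hB0 : 0 ≤ B := (abs_nonneg _).trans (hB 1 (by norm_num) le_rfl)
  let M : ℝ := B * 2 ^ s + C * 2 ^ s / (1 - q * 2 ^ s)
  have hden : 0 < 1 - q * 2 ^ s := by linarith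
  have hMB : B * 2 ^ s ≤ M := by
    have : 0 ≤ C * 2 ^ s / (1 - q * 2 ^ s) := by positivity
    simp only [M]; linarith
  have hM0 : 0 ≤ M := le_trans (by positivity) hMB
  have hMC : q * 2 ^ s * M + C * 2 ^ s ≤ M := by
    have h1 : C * 2 ^ s / (1 - q * 2 ^ s) ≤ M := by
      have : 0 ≤ B * 2 ^ s := by positivity
      simp only [M]; linarith
    rw [div_le_iff₀ hden] at h1
    linarith
  refine ⟨M, ?_⟩
  have key : ∀ n : ℕ, ∀ l, (1/2:ℝ) ^ (n+1) ≤ l → l ≤ 1 → |a l| ≤ M * l ^ s := by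
    intro n
    induction n with
    | zero =>
      intro l h1 h2
      have h1' : 1/2 ≤ l := by simpa using h1
      have e : (1/2:ℝ) ^ s ≤ l ^ s := Real.rpow_le_rpow (by norm_num) h1' hs.le
      have e2 : (2:ℝ) ^ s * (1/2) ^ s = 1 := by
        rw [← Real.mul_rpow (by norm_num) (by norm_num)]; norm_num
      calc |a l| ≤ B := hB l h1' h2
        _ = B * 2 ^ s * (1/2) ^ s := by rw [mul_assoc, e2, mul_one]
        _ ≤ M * l ^ s := by gcongr
    | succ n ih =>
      intro l h1 h2
      by_cases hl : 1/2 ≤ l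
      · refine ih l (le_trans ?_ hl) h2
        calc (1/2:ℝ) ^ (n+1) ≤ (1/2) ^ 1 := pow_le_pow_of_le_one (by norm_num) (by norm_num) (by omega)
          _ = 1/2 := by norm_num
      · push Not at hl
        have hl0 : 0 < l := lt_of_lt_of_le (by positivity) h1
        have i1 := ih (2 * l) (by rw [pow_succ] at h1; linarith) (by linarith)
        have i2 := hC (2 * l) (by linarith) (by linarith)
        rw [show 2 * l / 2 = l by ring] at i2
        rw [Real.mul_rpow (by norm_num) hl0.le] at i1 i2
        have i3 : |a l| ≤ |a l - q * a (2 * l)| + q * |a (2*l)| := by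
          have : a l = (a l - q * a (2 * l)) + q * a (2 * l) := by ring
          calc |a l| = |(a l - q * a (2 * l)) + q * a (2 * l)| := by rw [← this]
            _ ≤ |a l - q * a (2 * l)| + |q * a (2*l)| := abs_add_le _ _
            _ = _ := by rw [abs_mul, abs_of_nonneg hq0]
        have i4 : q * |a (2*l)| ≤ q * (M * (2 ^ s * l ^ s)) := by gcongr
        have hls : 0 ≤ l ^ s := by positivity
        calc |a l| ≤ C * (2 ^ s * l ^ s) + q * (M * (2 ^ s * l ^ s)) := by linarith
          _ = (q * 2 ^ s * M + C * 2 ^ s) * l ^ s := by ring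
          _ ≤ M * l ^ s := by gcongr
  intro l h0 h1
  obtain ⟨n, hn⟩ := exists_pow_lt_of_lt_one h0 (by norm_num : (1/2:ℝ) < 1)
  refine key n l (le_trans ?_ hn.le) h1
  exact pow_le_pow_of_le_one (by norm_num) (by norm_num) (by omega)

/-- dyadic telescoping -/
lemma telescope (F : ℝ → ℝ) (e C : ℝ) (he : 0 < e)
    (hC : ∀ l, 0 < l → l ≤ 1 → |F l - F (l/2)| ≤ C * l ^ e) :
    ∀ l, 0 < l → l ≤ 1 → (∃ G, Tendsto (fun j : ℕ => F (l / 2 ^ j)) atTop (𝓝 G)) ∧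
      ∀ G, Tendsto (fun j : ℕ => F (l / 2 ^ j)) atTop (𝓝 G) →
        |F l - G| ≤ C / (1 - (1/2) ^ e) * l ^ e := by
  intro l h0 h1
  have hr : ((1/2:ℝ) ^ e) < 1 := Real.rpow_lt_one (by norm_num) (by norm_num) he
  have hu : ∀ n : ℕ, dist (F (l / 2 ^ n)) (F (l / 2 ^ (n+1))) ≤ (C * l ^ e) * ((1/2:ℝ) ^ e) ^ n := by
    intro n
    have h := hC (l / 2 ^ n) (by positivity)
      (div_le_one_of_le₀ (h1.trans (one_le_pow₀ (by norm_num))) (by positivity))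
    rw [Real.dist_eq]
    have e1 : l / 2 ^ n / 2 = l / 2 ^ (n+1) := by rw [pow_succ]; field_simp
    have e2 : (l / 2 ^ n) ^ e = l ^ e * ((1/2:ℝ) ^ e) ^ n := by
      rw [← Real.rpow_natCast ((1/2:ℝ) ^ e) n, ← Real.rpow_mul (by norm_num), mul_comm e, Real.rpow_mul (by norm_num),
        ← Real.mul_rpow h0.le (by positivity)]
      congr 1
      rw [Real.rpow_natCast, one_div, inv_pow]
      rfl
    rw [e1, e2] at h
    linarith
  refine ⟨cauchySeq_tendsto_of_complete (cauchySeq_of_le_geometric _ _ hr hu), fun G hG => ?_⟩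
  have := dist_le_of_le_geometric_of_tendsto₀ _ _ hr hu hG
  rw [Real.dist_eq] at this
  simp only [pow_zero, div_one] at this
  rw [div_mul_eq_mul_div]
  exact this

lemma tendsto_dyadic {l : ℝ} (h0 : 0 < l) :
    Tendsto (fun j : ℕ => l / 2 ^ j) atTop (𝓝[>] (0:ℝ)) := by
  refine tendsto_nhdsWithin_iff.2 ⟨?_, Filter.Eventually.of_forall fun j => ?_⟩
  · have := (tendsto_pow_atTop_nhds_zero_of_lt_one (r := (1/2:ℝ)) (by norm_num) (by norm_num)).const_mul l
    simpa [div_eq_mul_inv] using this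
  · simp only [Set.mem_Ioi]; positivity

lemma tendsto_of_bound (F : ℝ → ℝ) (v e C : ℝ) (he : 0 < e)
    (h : ∀ l, 0 < l → l ≤ 1 → |F l - v| ≤ C * l ^ e) : Tendsto F (𝓝[>] (0:ℝ)) (𝓝 v) := by
  rw [tendsto_iff_dist_tendsto_zero]
  have h1 : Tendsto (fun l : ℝ => C * l ^ e) (𝓝[>] (0:ℝ)) (𝓝 0) := by
    have : ContinuousAt (fun l : ℝ => C * l ^ e) 0 :=
      continuousAt_const.mul (Real.continuousAt_rpow_const _ _ (Or.inr he.le))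
    have h2 := this.tendsto
    simp only [Real.zero_rpow he.ne', mul_zero] at h2
    exact h2.mono_left nhdsWithin_le_nhds
  refine squeeze_zero' (Filter.Eventually.of_forall fun _ => dist_nonneg) ?_ h1
  have hmem : Set.Ioc (0:ℝ) 1 ∈ 𝓝[>] (0:ℝ) := Ioc_mem_nhdsGT one_pos
  filter_upwards [hmem] with l hl
  rw [Real.dist_eq]
  exact h l hl.1 hl.2

lemma conv_of_telescope (F : ℝ → ℝ) (e C : ℝ) (he : 0 < e)
    (hC : ∀ l, 0 < l → l ≤ 1 → |F l - F (l/2)| ≤ C * l ^ e)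
    (hs : ∀ s, 0 < s → s ≤ 1 → Tendsto (fun l => F l - F (s * l)) (𝓝[>] (0:ℝ)) (𝓝 0)) :
    ∃ v, Tendsto F (𝓝[>] (0:ℝ)) (𝓝 v) := by
  obtain ⟨v, hv⟩ := (telescope F e C he hC 1 one_pos le_rfl).1
  refine ⟨v, tendsto_of_bound F v e (C / (1 - (1/2) ^ e)) he fun l h0 h1 => ?_⟩
  refine (telescope F e C he hC l h0 h1).2 v ?_
  have h2 := hv.sub ((hs l h0 h1).comp (tendsto_dyadic one_pos))
  refine (h2.congr fun j => ?_).trans (by simp)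
  simp only [Function.comp]
  rw [mul_one_div]
  ring

/-! main argument -/

lemma mem_TAnn {φ : Ed d → ℝ} (h : TU φ) {γ : ℝ}
    (h0 : ∀ l : MIdx d, (mdeg l : ℝ) ≤ γ → mom φ l = 0) : φ ∈ TAnn d γ :=
  ⟨h.1, h.2, h0⟩

lemma weak_decay {f : DFunc d} (hf : IsDistribution f) {x : Ed d} {δ : ℝ}
    (hbound : ∀ φ ∈ TAnn d δ, ∃ C : ℝ, ∀ l : ℝ, 0 < l → l ≤ 1 →
      |f (scTF φ x l)| ≤ C * l ^ δ) {φ : Ed d → ℝ} (h : TU φ)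
    (h0 : ∀ l : MIdx d, (mdeg l : ℝ) < δ → mom φ l = 0) {s : ℝ} (hs0 : 0 < s) (hs : s < δ) :
    ∃ M : ℝ, ∀ l : ℝ, 0 < l → l ≤ 1 → |f (scTF φ x l)| ≤ M * l ^ s := by
  have hpow : ∀ C l : ℝ, 0 < l → l ≤ 1 → C * l ^ δ ≤ |C| * l ^ s := by
    intro C l hl hl1
    have := Real.rpow_le_rpow_of_exponent_ge hl hl1 hs.le
    calc C * l ^ δ ≤ |C| * l ^ δ := by gcongr; exact le_abs_self C
      _ ≤ |C| * l ^ s := by gcongr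
  by_cases hn : ∃ n : ℕ, δ = n
  · obtain ⟨n, rfl⟩ := hn
    obtain ⟨B, hB0, hB⟩ := bdd_scale hf h x
    have hsc : TU (scTF φ 0 (1/2)) := h.scTF (by norm_num) (by norm_num)
    obtain ⟨C, hC⟩ := hbound (scTF φ 0 (1/2) + (-(1/2:ℝ) ^ n) • φ) (mem_TAnn (hsc.add (h.smul _))
      (by
        intro l hl
        rw [mom_add hsc.1 (h.smul _).1, mom_smul, mom_scTF _ (by norm_num)]
        rcases hl.lt_or_eq with h1 | h1
        · rw [h0 l h1]; ring
        · have : mdeg l = n := by exact_mod_cast h1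
          rw [this]; ring))
    refine decay_of_contract (fun l => f (scTF φ x l)) s ((1/2) ^ n) B |C| hs0 (by positivity) ?_ hB ?_
    · rw [one_div, inv_pow, ← Real.rpow_natCast, ← Real.rpow_neg (by norm_num),
        ← Real.rpow_add (by norm_num)]
      exact Real.rpow_lt_one_of_one_lt_of_neg (by norm_num) (by linarith)
    · intro l hl hl1
      have e := hC l hl hl1
      rw [scTF_add, scTF_smul, scTF_scTF, hf.1 _ _ (h.1.scTF x (by positivity))
        ((h.1.scTF x hl).smul _), hf.2.1 _ _ (h.1.scTF x hl)] at e
      have e2 : (1/2) * l = l / 2 := by ring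
      rw [e2] at e
      refine le_trans (le_of_eq ?_) (e.trans (hpow C l hl hl1))
      congr 1
      ring
  · push Not at hn
    obtain ⟨C, hC⟩ := hbound φ (mem_TAnn h fun l hl => h0 l (hl.lt_of_ne fun e => hn _ e.symm))
    exact ⟨|C|, fun l hl hl1 => (hC l hl hl1).trans (hpow C l hl hl1)⟩

lemma deriv_bound {f : DFunc d} (hf : IsDistribution f) {x : Ed d} {φ : Ed d → ℝ} (h : IsTest φ)
    (k : MIdx d) {s M : ℝ}
    (hM : ∀ l : ℝ, 0 < l → l ≤ 1 → |f (scTF (mderiv k φ) x l)| ≤ M * l ^ s) :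
    ∀ l : ℝ, 0 < l → l ≤ 1 → |distDeriv k f (scTF φ x l)| ≤ M * l ^ (s - mdeg k) := by
  intro l hl hl1
  rw [distDeriv_scTF hf h k x hl, abs_mul, abs_mul, abs_pow, abs_neg, abs_one, one_pow, one_mul,
    abs_of_pos (by positivity : 0 < l⁻¹ ^ mdeg k), Real.rpow_sub hl, Real.rpow_natCast]
  calc l⁻¹ ^ mdeg k * |f (scTF (mderiv k φ) x l)| ≤ l⁻¹ ^ mdeg k * (M * l ^ s) := by
        have := hM l hl hl1
        gcongr
    _ = M * (l ^ s / l ^ mdeg k) := by rw [inv_pow]; ring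

lemma weak_deriv {f : DFunc d} (hf : IsDistribution f) {x : Ed d} {δ : ℝ} (hδ : 0 < δ)
    (hbound : ∀ φ ∈ TAnn d δ, ∃ C : ℝ, ∀ l : ℝ, 0 < l → l ≤ 1 →
      |f (scTF φ x l)| ≤ C * l ^ δ) {φ : Ed d → ℝ} (h : TU φ)
    (h0 : ∀ l : MIdx d, (mdeg l : ℝ) < δ → mom φ l = 0) (k : MIdx d) (hk : (mdeg k : ℝ) < δ) :
    ∃ M e : ℝ, 0 < e ∧ ∀ l : ℝ, 0 < l → l ≤ 1 → |distDeriv k f (scTF φ x l)| ≤ M * l ^ e := by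
  have hk0 : (0:ℝ) ≤ mdeg k := by positivity
  obtain ⟨M, hM⟩ := weak_decay hf hbound (h.mderiv k) (mom_mderiv_zero_lt h.1 k h0)
    (s := (δ + mdeg k) / 2) (by linarith) (by linarith)
  exact ⟨M, (δ + mdeg k) / 2 - mdeg k, by linarith, deriv_bound hf h.1 k hM⟩

lemma strong_deriv {f : DFunc d} (hf : IsDistribution f) {x : Ed d} {δ : ℝ}
    (hbound : ∀ φ ∈ TAnn d δ, ∃ C : ℝ, ∀ l : ℝ, 0 < l → l ≤ 1 →
      |f (scTF φ x l)| ≤ C * l ^ δ) {φ : Ed d → ℝ} (h : TU φ)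
    (h0 : ∀ l : MIdx d, (mdeg l : ℝ) ≤ δ → mom φ l = 0) (k : MIdx d) :
    ∃ M : ℝ, ∀ l : ℝ, 0 < l → l ≤ 1 → |distDeriv k f (scTF φ x l)| ≤ M * l ^ (δ - mdeg k) := by
  obtain ⟨M, hM⟩ := hbound _ (mem_TAnn (h.mderiv k) (mom_mderiv_zero_le h.1 k h0))
  exact ⟨M, deriv_bound hf h.1 k hM⟩

lemma distDeriv_diff {f : DFunc d} (hf : IsDistribution f) {φ ψ : Ed d → ℝ} (h : IsTest φ)
    (h' : IsTest ψ) (k : MIdx d) (x : Ed d) {l : ℝ} (hl : 0 < l) :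
    distDeriv k f (scTF (φ + (-1:ℝ) • ψ) x l)
      = distDeriv k f (scTF φ x l) - distDeriv k f (scTF ψ x l) := by
  rw [scTF_add, scTF_smul, distDeriv_sub hf (h.scTF x hl) (h'.scTF x hl)]

lemma diff_tendsto {f : DFunc d} (hf : IsDistribution f) {x : Ed d} {δ : ℝ} (hδ : 0 < δ)
    (hbound : ∀ φ ∈ TAnn d δ, ∃ C : ℝ, ∀ l : ℝ, 0 < l → l ≤ 1 →
      |f (scTF φ x l)| ≤ C * l ^ δ) {φ ψ : Ed d → ℝ} (h : TU φ) (h' : TU ψ)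
    (h0 : ∀ l : MIdx d, (mdeg l : ℝ) < δ → mom φ l = mom ψ l) (k : MIdx d)
    (hk : (mdeg k : ℝ) < δ) :
    ∃ M e : ℝ, 0 < e ∧ ∀ l : ℝ, 0 < l → l ≤ 1 →
      |distDeriv k f (scTF φ x l) - distDeriv k f (scTF ψ x l)| ≤ M * l ^ e := by
  obtain ⟨M, e, he, hM⟩ := weak_deriv hf hδ hbound (h.add (h'.smul (-1))) (by
    intro l hl
    rw [mom_add h.1 (h'.smul _).1, mom_smul, h0 l hl]
    ring) k hk
  refine ⟨M, e, he, fun l hl hl1 => ?_⟩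
  rw [← distDeriv_diff hf h.1 h'.1 k x hl]
  exact hM l hl hl1

/-- two admissible mollifiers share the moments of order `< δ` -/
lemma good_mom {δ : ℝ} {η : Ed d → ℝ} (h : GoodEta δ η) (l : MIdx d) (hl : (mdeg l : ℝ) < δ) :
    mom η l = if l = 0 then 1 else 0 := by
  split_ifs with h0
  · rw [h0, mom_zero_idx, h.2.1]
  · exact h.2.2 l (Nat.one_le_iff_ne_zero.2 fun e => h0 (mdeg_eq_zero e)) hl

lemma GoodEta.scTF {δ : ℝ} {η : Ed d → ℝ} (h : GoodEta δ η) {s : ℝ} (hs : 0 < s) :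
    GoodEta δ (scTF η 0 s) := by
  refine ⟨h.1.scTF 0 hs, ?_, fun k h1 h2 => ?_⟩
  · rw [← mom_zero_idx, mom_scTF _ hs, mdeg_zero, pow_zero, one_mul, mom_zero_idx, h.2.1]
  · have := mom_scTF η hs k
    rw [show mom η k = 0 from h.2.2 k h1 h2, mul_zero] at this
    exact this

lemma part_one {f : DFunc d} (hf : IsDistribution f) {x : Ed d} {δ : ℝ} (hδ : 0 < δ)
    (hbound : ∀ φ ∈ TAnn d δ, ∃ C : ℝ, ∀ l : ℝ, 0 < l → l ≤ 1 →
      |f (scTF φ x l)| ≤ C * l ^ δ) {η : Ed d → ℝ} (hη : TU η) (hg : GoodEta δ η) (k : MIdx d)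
    (hk : (mdeg k : ℝ) < δ) : ∃ v : ℝ, HasPtDeriv f δ k x v := by
  have cmp : ∀ η' : Ed d → ℝ, TU η' → GoodEta δ η' → ∃ M e : ℝ, 0 < e ∧ ∀ l : ℝ, 0 < l → l ≤ 1 →
      |distDeriv k f (_root_.scTF η x l) - distDeriv k f (_root_.scTF η' x l)| ≤ M * l ^ e := fun η' h1 h2 =>
    diff_tendsto hf hδ hbound hη h1 (fun l hl => by rw [good_mom hg l hl, good_mom h2 l hl]) k hk
  have cmpt : ∀ η' : Ed d → ℝ, TU η' → GoodEta δ η' → Tendsto (fun l : ℝ =>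
      distDeriv k f (_root_.scTF η x l) - distDeriv k f (_root_.scTF η' x l)) (𝓝[>] (0:ℝ)) (𝓝 0) := by
    intro η' h1 h2
    obtain ⟨M, e, he, hM⟩ := cmp η' h1 h2
    exact tendsto_of_bound _ 0 e M he (by simpa using hM)
  obtain ⟨M, e, he, hM⟩ := cmp _ (hη.scTF (s := 1/2) (by norm_num) (by norm_num))
    (hg.scTF (by norm_num))
  obtain ⟨v, hv⟩ := conv_of_telescope (fun l => distDeriv k f (_root_.scTF η x l)) e M he
    (by
      intro l hl hl1
      have := hM l hl hl1
      rw [scTF_scTF, show (1/2) * l = l / 2 by ring] at this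
      exact this)
    (by
      intro s hs hs1
      have := cmpt _ (hη.scTF hs hs1) (hg.scTF hs)
      simpa only [scTF_scTF] using this)
  refine ⟨v, fun ζ hζ => ?_⟩
  obtain ⟨R, hR⟩ := hζ.1.2.isCompact.isBounded.subset_closedBall (0 : Ed d)
  have hR1 : 0 < max R 1 := by positivity
  have hinv : 0 < (max R 1)⁻¹ := by positivity
  have hT : TU (_root_.scTF ζ 0 (max R 1)⁻¹) := by
    refine ⟨hζ.1.scTF 0 hinv, (scTF_tsupport hR 0 hinv).trans (closedBall_subset_closedBall ?_)⟩
    rw [inv_mul_le_iff₀ hR1, mul_one]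
    exact le_max_left _ _
  have h1 := hv.sub (cmpt _ hT (hζ.scTF hinv))
  have h2 : Tendsto (fun l : ℝ => max R 1 * l) (𝓝[>] (0:ℝ)) (𝓝[>] (0:ℝ)) := by
    refine tendsto_nhdsWithin_iff.2 ⟨?_, ?_⟩
    · have : ContinuousAt (fun l : ℝ => max R 1 * l) 0 := by fun_prop
      have := this.tendsto
      rw [mul_zero] at this
      exact this.mono_left nhdsWithin_le_nhds
    · filter_upwards [self_mem_nhdsWithin] with l hl
      exact mul_pos hR1 hl
  have h3 := h1.comp h2
  simp only [sub_zero] at h3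
  refine h3.congr fun l => ?_
  simp only [Function.comp, sub_sub_cancel, scTF_scTF]
  rw [← mul_assoc, inv_mul_cancel₀ hR1.ne', one_mul]

lemma part_two {f : DFunc d} (hf : IsDistribution f) {x : Ed d} {δ : ℝ}
    (hbound : ∀ φ ∈ TAnn d δ, ∃ C : ℝ, ∀ l : ℝ, 0 < l → l ≤ 1 →
      |f (scTF φ x l)| ≤ C * l ^ δ) {η : Ed d → ℝ} (hη : TU η) (hg : GoodEta δ η)
    (h0 : ∀ l : MIdx d, 1 ≤ mdeg l → (mdeg l : ℝ) ≤ δ → mom η l = 0)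
    (hor : (∀ n : ℕ, δ ≠ (n : ℝ)) ∨
        (∀ k : MIdx d, (mdeg k : ℝ) = δ →
          ∀ φ : Ed d → ℝ, IsTest φ → tsupport φ ⊆ closedBall (0 : Ed d) 1 →
            ∃ C : ℝ, ∀ l : ℝ, 0 < l → l ≤ 1 → |distDeriv k f (scTF φ x l)| ≤ C))
    (Dv : MIdx d → ℝ) (hDv : ∀ k : MIdx d, (mdeg k : ℝ) < δ → HasPtDeriv f δ k x (Dv k))
    {ψ : Ed d → ℝ} (hψ : TU ψ) :
    ∃ C : ℝ, ∀ l : ℝ, 0 < l → l ≤ 1 →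
          |f (scTF ψ x l) - taylorF δ Dv x (scTF ψ x l)| ≤ C * l ^ δ := by
  have h1 : mom η 0 = 1 := by rw [mom_zero_idx, hg.2.1]
  have hfin : {k : MIdx d | (mdeg k : ℝ) ≤ δ}.Finite := by
    refine (finite_mdeg ⌊δ⌋₊).subset fun k hk => ?_
    exact Nat.le_floor hk
  let K := hfin.toFinset
  have hK : ∀ k, k ∈ K ↔ (mdeg k : ℝ) ≤ δ := by simp [K]
  -- sharp convergence
  have hrate : ∀ k : MIdx d, ∃ C : ℝ, k ∈ K → ∀ l : ℝ, 0 < l → l ≤ 1 →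
      |distDeriv k f (scTF η x l) - (if (mdeg k : ℝ) < δ then Dv k else 0)|
        ≤ C * l ^ (δ - mdeg k) := by
    intro k
    by_cases hkK : k ∈ K
    swap
    · exact ⟨0, fun h => absurd h hkK⟩
    by_cases hk : (mdeg k : ℝ) < δ
    · simp only [hk, if_true]
      have hs : TU (scTF η 0 (1/2)) := hη.scTF (by norm_num) (by norm_num)
      obtain ⟨M, hM⟩ := strong_deriv hf hbound (hη.add (hs.smul (-1))) (by
        intro l hl
        rw [mom_add hη.1 (hs.smul _).1, mom_smul, mom_scTF _ (by norm_num)]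
        by_cases hl0 : mdeg l = 0
        · rw [hl0]; ring
        · rw [h0 l (Nat.one_le_iff_ne_zero.2 hl0) hl]; ring) k
      refine ⟨M / (1 - (1/2) ^ (δ - mdeg k)), fun _ l hl hl1 => ?_⟩
      refine (telescope (fun l => distDeriv k f (scTF η x l)) (δ - mdeg k) M (by linarith) ?_ l hl
        hl1).2 _ ((hDv k hk η hg).comp (tendsto_dyadic hl))
      intro l hl hl1
      have := hM l hl hl1
      rw [distDeriv_diff hf hη.1 hs.1 k x hl, scTF_scTF, show (1/2) * l = l / 2 by ring] at this
      exact this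
    · have hkδ : (mdeg k : ℝ) = δ := le_antisymm ((hK k).1 hkK) (not_lt.1 hk)
      rcases hor with hor | hor
      · exact absurd hkδ.symm (hor _)
      · obtain ⟨C, hC⟩ := hor k hkδ η hη.1 hη.2
        refine ⟨C, fun _ l hl hl1 => ?_⟩
        rw [if_neg hk, sub_zero, hkδ, sub_self, Real.rpow_zero, mul_one]
        exact hC l hl hl1
  choose Ck hCk using hrate
  -- decomposition
  let c : MIdx d → ℝ := fun k => (-1) ^ mdeg k * (mom ψ k / mfact k)
  let S : Ed d → ℝ := ∑ k ∈ K, c k • mderiv k η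
  have hTS : ∀ k ∈ K, TU (c k • mderiv k η) := fun k _ => (hη.mderiv k).smul _
  have hS : TU S := TU.sum K _ hTS
  have hmf : ∀ k : MIdx d, (mfact k : ℝ) ≠ 0 := by
    intro k
    have : mfact k ≠ 0 := Finset.prod_ne_zero_iff.2 fun i _ => Nat.factorial_ne_zero _
    exact_mod_cast this
  have hsign : ∀ n : ℕ, (-1:ℝ) ^ n * (-1) ^ n = 1 := fun n => by
    rw [← mul_pow]; simp
  obtain ⟨C0, hC0⟩ := hbound (ψ + (-1:ℝ) • S) (mem_TAnn (hψ.add (hS.smul _)) (by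
    intro l hl
    rw [mom_add hψ.1 (hS.smul _).1, mom_smul, mom_sum K _ hTS]
    have : ∑ k ∈ K, mom (c k • mderiv k η) l = mom ψ l := by
      rw [Finset.sum_eq_single l]
      · rw [mom_smul, mom_eta hη.1 h1 h0 l l hl, if_pos rfl]
        simp only [c]
        have e1 := hsign (mdeg l)
        have e2 := hmf l
        field_simp
        linear_combination mom ψ l * e1
      · intro k _ hkl
        rw [mom_smul, mom_eta hη.1 h1 h0 k l hl, if_neg (Ne.symm hkl), mul_zero]
      · intro hl'
        exact absurd ((hK l).2 hl) hl'
    rw [this]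
    ring))
  refine ⟨C0 + ∑ k ∈ K, |mom ψ k / mfact k| * Ck k, fun l hl hl1 => ?_⟩
  have hfψ : f (scTF ψ x l) = f (scTF (ψ + (-1:ℝ) • S) x l) + f (scTF S x l) := by
    rw [scTF_add, scTF_smul, hf.1 _ _ (hψ.1.scTF x hl) ((hS.1.scTF x hl).smul _),
      hf.2.1 _ _ (hS.1.scTF x hl)]
    ring
  have hfS : f (scTF S x l)
      = ∑ k ∈ K, mom ψ k / mfact k * (l ^ mdeg k * distDeriv k f (scTF η x l)) := by
    simp only [S]
    rw [scTF_sum, (f_sum hf K _ fun k hk => (hTS k hk).1.scTF x hl).2]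
    refine Finset.sum_congr rfl fun k _ => ?_
    rw [scTF_smul, hf.2.1 _ _ ((hη.mderiv k).1.scTF x hl), distDeriv_scTF hf hη.1 k x hl]
    simp only [c]
    have : l ^ mdeg k * l⁻¹ ^ mdeg k = 1 := by
      rw [← mul_pow, mul_inv_cancel₀ hl.ne', one_pow]
    linear_combination (-((-1) ^ mdeg k * (mom ψ k / mfact k) * f (scTF (mderiv k η) x l))) * this
  have hT : taylorF δ Dv x (scTF ψ x l)
      = ∑ k ∈ K, mom ψ k / mfact k * (l ^ mdeg k * (if (mdeg k : ℝ) < δ then Dv k else 0)) := by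
    unfold taylorF
    have hset : {k : MIdx d | (mdeg k : ℝ) < δ} = ↑(K.filter fun k => (mdeg k : ℝ) < δ) := by
      ext k
      simp only [Set.mem_setOf_eq, Finset.coe_filter, hK]
      exact ⟨fun h => ⟨h.le, h⟩, fun h => h.2⟩
    rw [hset, finsum_mem_coe_finset, Finset.sum_filter]
    refine Finset.sum_congr rfl fun k _ => ?_
    rw [mom_scTF_gen _ _ hl]
    split_ifs <;> ring
  rw [hfψ, hfS, hT, add_sub_assoc, ← Finset.sum_sub_distrib, add_mul, Finset.sum_mul]
  refine (abs_add_le _ _).trans (add_le_add (hC0 l hl hl1) ?_)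
  refine (Finset.abs_sum_le_sum_abs _ _).trans (Finset.sum_le_sum fun k hk => ?_)
  rw [← mul_sub, ← mul_sub, abs_mul, abs_mul, abs_of_pos (by positivity : 0 < l ^ mdeg k), mul_assoc]
  refine mul_le_mul_of_nonneg_left ?_ (abs_nonneg _)
  calc l ^ mdeg k * |distDeriv k f (scTF η x l) - (if (mdeg k : ℝ) < δ then Dv k else 0)|
      ≤ l ^ mdeg k * (Ck k * l ^ (δ - mdeg k)) :=
        mul_le_mul_of_nonneg_left (hCk k hk l hl hl1) (by positivity)
    _ = Ck k * l ^ δ := by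
        rw [Real.rpow_sub hl, Real.rpow_natCast]
        field_simp

/-- Lemma 3.7, pointwise derivatives: let `f ∈ 𝒟'` satisfy
`|f(φ_x^λ)| ≲ λ^δ` for `λ ∈ (0,1]`, for every fixed `φ ∈ 𝓑_δ`.  Then:
(1) for every `|k| < δ` the pointwise derivative `D^k f(x) = lim_{λ↓0} D^k f(η_x^λ)`
exists and is independent of the admissible mollifier `η`;
(2) if `δ ∉ ℕ`, subtracting the Taylor polynomial `𝒯^δ_x(f)` yields
`|(f - 𝒯^δ_x f)(ψ_x^λ)| ≲ λ^δ` for any fixed test function `ψ` supported in `B(0,1)`;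
(3) the bound in (2) also holds for `δ ∈ ℕ` provided
`sup_{λ ∈ (0,1]} |D^k f(φ_x^λ)| ≲ 1` for every `|k| = δ` and every such `φ`. -/
theorem pointwise_derivatives
    (d : ℕ) (f : DFunc d) (hf : IsDistribution f) (x : Ed d) (δ : ℝ) (hδ : 0 < δ)
    (hbound : ∀ φ ∈ TAnn d δ, ∃ C : ℝ, ∀ l : ℝ, 0 < l → l ≤ 1 →
      |f (scTF φ x l)| ≤ C * l ^ δ) :
    -- (1) existence and independence of the pointwise derivatives
    (∀ k : MIdx d, (mdeg k : ℝ) < δ → ∃ v : ℝ, HasPtDeriv f δ k x v) ∧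
    -- (2) and (3): the strong homogeneity bound after subtracting the Taylor polynomial
    (((∀ n : ℕ, δ ≠ (n : ℝ)) ∨
        (∀ k : MIdx d, (mdeg k : ℝ) = δ →
          ∀ φ : Ed d → ℝ, IsTest φ → tsupport φ ⊆ closedBall (0 : Ed d) 1 →
            ∃ C : ℝ, ∀ l : ℝ, 0 < l → l ≤ 1 → |distDeriv k f (scTF φ x l)| ≤ C)) →
      ∀ Dv : MIdx d → ℝ, (∀ k : MIdx d, (mdeg k : ℝ) < δ → HasPtDeriv f δ k x (Dv k)) →
      ∀ ψ : Ed d → ℝ, IsTest ψ → tsupport ψ ⊆ closedBall (0 : Ed d) 1 →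
        ∃ C : ℝ, ∀ l : ℝ, 0 < l → l ≤ 1 →
          |f (scTF ψ x l) - taylorF δ Dv x (scTF ψ x l)| ≤ C * l ^ δ) := by
  obtain ⟨η, hη, h1, h0⟩ := exists_eta d ⌊δ⌋₊
  have h0' : ∀ l : MIdx d, 1 ≤ mdeg l → (mdeg l : ℝ) ≤ δ → mom η l = 0 :=
    fun l hl hl' => h0 l hl (Nat.le_floor hl')
  have hg : GoodEta δ η :=
    ⟨hη.1, by rw [← mom_zero_idx, h1], fun k hk hk' => h0' k hk hk'.le⟩
  refine ⟨fun k hk => part_one hf hδ hbound hη hg k hk, ?_⟩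
  intro hor Dv hDv ψ hψ hψs
  exact part_two hf hbound hη hg h0' hor Dv hDv ⟨hψ, hψs⟩
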